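/- Let d ≥ 1 and let f : ℝ^d → ℝ be twice continuously differentiable and ρ-Hessian Lipschitz. For μ > 0 let ∇̂_rand f(x) = d·((f(x+μu) − f(x−μu))/(2μ))·u with u uniform on the unit sphere S^{d−1} ⊂ ℝ^d. Then for every x ∈ ℝ^d, ‖E_u[∇̂_rand f(x)] − ∇f(x)‖ ≤ ρ d μ²/6. -/

import Mathlib

open MeasureTheory

/-- The central-difference random gradient estimator
`∇̂_rand f(x) = d·((f(x+μu) − f(x−μu))/(2μ))·u`. -/
noncomputable def randGrad (d : ℕ) (f : EuclideanSpace ℝ (Fin d) → ℝ) (μ : ℝ)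
    (x u : EuclideanSpace ℝ (Fin d)) : EuclideanSpace ℝ (Fin d) :=
  ((d : ℝ) * ((f (x + μ • u) - f (x - μ • u)) / (2 * μ))) • u

/-- The uniform probability measure on the unit sphere of `ℝ^d`, obtained by normalizing the
surface measure `volume.toSphere` and pushing it forward to `ℝ^d`. -/
noncomputable def sphereUniform (d : ℕ) : Measure (EuclideanSpace ℝ (Fin d)) :=
  ((volume : Measure (EuclideanSpace ℝ (Fin d))).toSphere Set.univ)⁻¹ •
    Measure.map Subtype.val (volume : Measure (EuclideanSpace ℝ (Fin d))).toSphere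

section SphereUniform

variable {d : ℕ}

open scoped Pointwise in
/-- The uniform measure on the sphere is invariant under linear isometries. -/
theorem sphereUniform_map_linearIsometryEquiv
    (L : EuclideanSpace ℝ (Fin d) ≃ₗᵢ[ℝ] EuclideanSpace ℝ (Fin d)) :
    (sphereUniform d).map L = sphereUniform d := by
  have hL : Measurable L := L.continuous.measurable
  ext s hs
  rw [Measure.map_apply hL hs]
  simp only [sphereUniform, Measure.smul_apply]
  rw [Measure.map_apply measurable_subtype_coe (hL hs),
    Measure.map_apply measurable_subtype_coe hs,
    Measure.toSphere_apply' _ (measurable_subtype_coe (hL hs)),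
    Measure.toSphere_apply' _ (measurable_subtype_coe hs)]
  have key : Set.Ioo (0 : ℝ) 1 • ((Subtype.val : Metric.sphere (0 : EuclideanSpace ℝ (Fin d)) 1 → _) ''
        (Subtype.val ⁻¹' (L ⁻¹' s)))
      = L ⁻¹' (Set.Ioo (0 : ℝ) 1 •
        ((Subtype.val : Metric.sphere (0 : EuclideanSpace ℝ (Fin d)) 1 → _) ''
          (Subtype.val ⁻¹' s))) := by
    ext y
    simp only [Subtype.image_preimage_coe, Set.mem_smul, Set.mem_preimage, Set.mem_inter_iff,
      mem_sphere_zero_iff_norm]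
    constructor
    · rintro ⟨r, hr, z, ⟨hz, hzs⟩, rfl⟩
      exact ⟨r, hr, L z, ⟨by simpa using hz, hzs⟩, by simp⟩
    · rintro ⟨r, hr, z, ⟨hz, hzs⟩, h⟩
      refine ⟨r, hr, L.symm z, ⟨by simpa using hz, by simpa using hzs⟩, ?_⟩
      apply L.injective
      simpa using h
  rw [key, L.measurePreserving.measure_preimage_emb L.toHomeomorph.measurableEmbedding]

theorem isProbabilityMeasure_sphereUniform (hd : 1 ≤ d) :
    IsProbabilityMeasure (sphereUniform d) := by
  have : NeZero d := ⟨by omega⟩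
  constructor
  simp only [sphereUniform, Measure.smul_apply]
  rw [Measure.map_apply measurable_subtype_coe .univ, Set.preimage_univ, smul_eq_mul]
  exact ENNReal.inv_mul_cancel (by
    rw [Ne, Measure.measure_univ_eq_zero]
    exact Measure.toSphere_ne_zero _) (measure_ne_top _ _)

theorem ae_sphereUniform_norm_eq_one : ∀ᵐ u ∂(sphereUniform d), ‖u‖ = 1 := by
  refine Measure.ae_smul_measure ?_ _
  rw [ae_map_iff measurable_subtype_coe.aemeasurable
    (measurableSet_eq_fun measurable_norm measurable_const)]
  exact .of_forall fun u => by simp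

theorem Continuous.integrable_sphereUniform {F : Type*} [NormedAddCommGroup F]
    {g : EuclideanSpace ℝ (Fin d) → F} (hg : Continuous g) :
    Integrable g (sphereUniform d) := by
  rcases Nat.eq_zero_or_pos d with rfl | hd
  · have : sphereUniform 0 = 0 := by
      have h : (volume : Measure (EuclideanSpace ℝ (Fin 0))).toSphere = 0 :=
        (Measure.toSphere_eq_zero_iff _).2 inferInstance
      simp [sphereUniform, h]
    simp [this]
  have := isProbabilityMeasure_sphereUniform hd
  obtain ⟨C, hC⟩ := (isCompact_sphere (0 : EuclideanSpace ℝ (Fin d)) 1).exists_bound_of_continuousOn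
    hg.continuousOn
  refine Integrable.of_bound hg.aestronglyMeasurable C ?_
  filter_upwards [ae_sphereUniform_norm_eq_one] with u hu
  exact hC u (by simpa using hu)

theorem integral_inner_sq_sphereUniform_eq_of_norm_eq {v w : EuclideanSpace ℝ (Fin d)}
    (h : ‖v‖ = ‖w‖) :
    ∫ u, inner ℝ v u ^ 2 ∂(sphereUniform d) = ∫ u, inner ℝ w u ^ 2 ∂(sphereUniform d) := by
  set L := (ℝ ∙ (v - w))ᗮ.reflection
  have hv : L v = w := Submodule.reflection_sub h
  conv_rhs => rw [← sphereUniform_map_linearIsometryEquiv L]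
  rw [integral_map L.continuous.measurable.aemeasurable (by fun_prop)]
  simp only [← hv, L.inner_map_map]

/-- The second moment of the uniform distribution on the sphere is isotropic. -/
theorem integral_inner_sq_sphereUniform (hd : 1 ≤ d) (v : EuclideanSpace ℝ (Fin d)) :
    ∫ u, inner ℝ v u ^ 2 ∂(sphereUniform d) = ‖v‖ ^ 2 / d := by
  have := isProbabilityMeasure_sphereUniform hd
  have hQ (i : Fin d) : ∫ u, inner ℝ v u ^ 2 ∂(sphereUniform d)
      = ‖v‖ ^ 2 * ∫ u, u i ^ 2 ∂(sphereUniform d) := by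
    rw [integral_inner_sq_sphereUniform_eq_of_norm_eq
      (w := ‖v‖ • EuclideanSpace.single i (1 : ℝ)) (by simp [norm_smul]), ← integral_const_mul]
    simp [inner_smul_left, EuclideanSpace.inner_single_left, mul_pow]
  have hsum : ∑ i, ∫ u : EuclideanSpace ℝ (Fin d), u i ^ 2 ∂(sphereUniform d) = 1 := by
    rw [← integral_finsetSum _ fun i _ =>
      Continuous.integrable_sphereUniform (by fun_prop)]
    rw [integral_congr_ae (g := fun _ => (1 : ℝ))]
    · simp
    · filter_upwards [ae_sphereUniform_norm_eq_one] with u hu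
      rw [← EuclideanSpace.real_norm_sq_eq, hu, one_pow]
  have hd0 : (d : ℝ) ≠ 0 := by positivity
  have h : ∑ _i : Fin d, ∫ u, inner ℝ v u ^ 2 ∂(sphereUniform d) = ‖v‖ ^ 2 := by
    rw [Finset.sum_congr rfl fun i _ => hQ i, ← Finset.mul_sum, hsum, mul_one]
  rw [eq_div_iff hd0, ← h]
  simp [mul_comm]

theorem integral_inner_smul_sphereUniform (hd : 1 ≤ d) (g : EuclideanSpace ℝ (Fin d)) :
    ∫ u, ((d : ℝ) * inner ℝ g u) • u ∂(sphereUniform d) = g := by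
  have hd0 : (d : ℝ) ≠ 0 := by positivity
  refine ext_inner_left ℝ fun h => ?_
  have hpol (u : EuclideanSpace ℝ (Fin d)) : inner ℝ h (((d : ℝ) * inner ℝ g u) • u)
      = d / 4 * (inner ℝ (h + g) u ^ 2 - inner ℝ (h - g) u ^ 2) := by
    rw [inner_smul_right, inner_add_left, inner_sub_left]
    ring
  rw [← integral_inner (Continuous.integrable_sphereUniform (by fun_prop)),
    integral_congr_ae (.of_forall hpol), integral_const_mul, integral_sub
      (Continuous.integrable_sphereUniform (by fun_prop))
      (Continuous.integrable_sphereUniform (by fun_prop)),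
    integral_inner_sq_sphereUniform hd, integral_inner_sq_sphereUniform hd,
    norm_add_sq_real, norm_sub_sq_real]
  field_simp
  ring

end SphereUniform

section CentralDifference

variable {E : Type*} [NormedAddCommGroup E] [InnerProductSpace ℝ E] [CompleteSpace E]

theorem ContDiff.differentiable_gradient {f : E → ℝ} (hf : ContDiff ℝ 2 f) :
    Differentiable ℝ (gradient f) :=
  (InnerProductSpace.toDual ℝ E).symm.differentiable.comp
    ((hf.fderiv_right (m := 1) (by norm_num)).differentiable (by norm_num))

/-- The error of the central difference along a unit vector, for a function with Lipschitz
Hessian. -/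
theorem abs_central_difference_sub_inner_gradient_le {f : E → ℝ} {ρ : ℝ} (hf : ContDiff ℝ 2 f)
    (hLip : ∀ x y : E, ‖fderiv ℝ (gradient f) x - fderiv ℝ (gradient f) y‖ ≤ ρ * ‖x - y‖)
    (x : E) {u : E} (hu : ‖u‖ = 1) {μ : ℝ} (hμ : 0 < μ) :
    |(f (x + μ • u) - f (x - μ • u)) / (2 * μ) - inner ℝ (gradient f x) u| ≤ ρ * μ ^ 2 / 6 := by
  have hp (t : ℝ) : HasDerivAt (fun t : ℝ => x + t • u) u t := by
    simpa using ((hasDerivAt_id t).smul_const u).const_add x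
  have hm (t : ℝ) : HasDerivAt (fun t : ℝ => x - t • u) (-u) t := by
    simpa using ((hasDerivAt_id t).smul_const u).const_sub x
  have hf1 (y : E) : HasFDerivAt f (fderiv ℝ f y) y :=
    (hf.differentiable (by norm_num) y).hasFDerivAt
  have hg1 (y : E) : HasFDerivAt (gradient f) (fderiv ℝ (gradient f) y) y :=
    (hf.differentiable_gradient y).hasFDerivAt
  have hφ (t : ℝ) : HasDerivAt
      (fun t : ℝ => f (x + t • u) - f (x - t • u) - 2 * t * inner ℝ (gradient f x) u)
      (inner ℝ (gradient f (x + t • u) + gradient f (x - t • u) - (2 : ℝ) • gradient f x) u) t := by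
    have h1 := (hf1 (x + t • u)).comp_hasDerivAt t (hp t)
    have h2 := (hf1 (x - t • u)).comp_hasDerivAt t (hm t)
    have h3 := ((hasDerivAt_id t).const_mul 2).mul_const (inner ℝ (gradient f x) u)
    refine ((h1.sub h2).sub h3).congr_deriv ?_
    simp only [inner_sub_left, inner_add_left, inner_smul_left, inner_gradient_left]
    simp
  have hψ (t : ℝ) : HasDerivAt
      (fun t : ℝ => gradient f (x + t • u) + gradient f (x - t • u) - (2 : ℝ) • gradient f x)
      ((fderiv ℝ (gradient f) (x + t • u) - fderiv ℝ (gradient f) (x - t • u)) u) t := by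
    have h1 := (hg1 (x + t • u)).comp_hasDerivAt t (hp t)
    have h2 := (hg1 (x - t • u)).comp_hasDerivAt t (hm t)
    refine ((h1.add h2).sub_const _).congr_deriv ?_
    simp [sub_eq_add_neg]
  have hψ_le : ∀ t ∈ Set.Icc 0 μ,
      ‖gradient f (x + t • u) + gradient f (x - t • u) - (2 : ℝ) • gradient f x‖ ≤ ρ * t ^ 2 := by
    refine image_norm_le_of_norm_deriv_right_le_deriv_boundary
      (B := fun t => ρ * t ^ 2) (B' := fun t => ρ * (2 * t))
      (fun t _ => (hψ t).continuousAt.continuousWithinAt) (fun t _ => (hψ t).hasDerivWithinAt)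
      (by simp [two_smul]) (fun t => ?_) fun t ht => ?_
    · simpa using (hasDerivAt_pow 2 t).const_mul ρ
    · refine ((ContinuousLinearMap.le_opNorm _ _).trans_eq (by rw [hu, mul_one])).trans
        ((hLip _ _).trans_eq ?_)
      have : x + t • u - (x - t • u) = (2 * t) • u := by rw [mul_smul, two_smul]; abel
      rw [this, norm_smul, hu, mul_one, Real.norm_of_nonneg (by linarith [ht.1])]
  have hφ_le : ∀ t ∈ Set.Icc 0 μ,
      ‖f (x + t • u) - f (x - t • u) - 2 * t * inner ℝ (gradient f x) u‖ ≤ ρ * t ^ 3 / 3 := by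
    refine image_norm_le_of_norm_deriv_right_le_deriv_boundary
      (B := fun t => ρ * t ^ 3 / 3) (B' := fun t => ρ * t ^ 2)
      (fun t _ => (hφ t).continuousAt.continuousWithinAt) (fun t _ => (hφ t).hasDerivWithinAt)
      (by simp) (fun t => ?_) fun t ht => ?_
    · refine (((hasDerivAt_pow 3 t).const_mul ρ).div_const 3).congr_deriv ?_
      norm_num
      ring
    · refine (norm_inner_le_norm _ _).trans ?_
      rw [hu, mul_one]
      exact hψ_le t ⟨ht.1, ht.2.le⟩
  have h := hφ_le μ ⟨hμ.le, le_rfl⟩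
  have heq : (f (x + μ • u) - f (x - μ • u)) / (2 * μ) - inner ℝ (gradient f x) u
      = (f (x + μ • u) - f (x - μ • u) - 2 * μ * inner ℝ (gradient f x) u) / (2 * μ) := by
    field_simp
  rw [heq, abs_div, abs_of_pos (by positivity : 0 < 2 * μ), div_le_iff₀ (by positivity)]
  rw [Real.norm_eq_abs] at h
  linarith

end CentralDifference

/-- If `f : ℝ^d → ℝ` (`d ≥ 1`) is twice continuously differentiable and `ρ`-Hessian Lipschitz,
then for every `μ > 0` and every `x`,
`‖E_u[∇̂_rand f(x)] − ∇f(x)‖ ≤ ρ d μ²/6` where `u` is uniform on the unit sphere. -/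
theorem randGrad_mean_error_bound (d : ℕ) (hd : 1 ≤ d)
    (f : EuclideanSpace ℝ (Fin d) → ℝ) (ρ : ℝ)
    (hf : ContDiff ℝ 2 f)
    (hHessLip : ∀ x y : EuclideanSpace ℝ (Fin d),
      ‖fderiv ℝ (gradient f) x - fderiv ℝ (gradient f) y‖ ≤ ρ * ‖x - y‖)
    (μ : ℝ) (hμ : 0 < μ) (x : EuclideanSpace ℝ (Fin d)) :
    ‖(∫ u, randGrad d f μ x u ∂(sphereUniform d)) - gradient f x‖ ≤ ρ * d * μ ^ 2 / 6 := by
  have := isProbabilityMeasure_sphereUniform hd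
  have hfc : Continuous f := hf.continuous
  have hInt_f : Integrable (fun u => randGrad d f μ x u) (sphereUniform d) :=
    Continuous.integrable_sphereUniform (by unfold randGrad; fun_prop)
  have hInt_g : Integrable (fun u => ((d : ℝ) * inner ℝ (gradient f x) u) • u) (sphereUniform d) :=
    Continuous.integrable_sphereUniform (by fun_prop)
  conv_lhs => rw [← integral_inner_smul_sphereUniform hd (gradient f x)]
  rw [← integral_sub hInt_f hInt_g]
  refine (norm_integral_le_of_norm_le_const (C := ρ * d * μ ^ 2 / 6) ?_).trans_eq (by simp)
  filter_upwards [ae_sphereUniform_norm_eq_one] with u hu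
  rw [randGrad, ← sub_smul, ← mul_sub, norm_smul, hu, mul_one, norm_mul, Real.norm_natCast,
    Real.norm_eq_abs]
  refine (mul_le_mul_of_nonneg_left
    (abs_central_difference_sub_inner_gradient_le hf hHessLip x hu hμ) d.cast_nonneg).trans_eq ?_
  ring
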